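/- (Gradient vanishing along gradient descent.) Let f : ℝ^n → ℝ be a differentiable function whose gradient is H-Lipschitz (H > 0) and which is bounded below, and let 0 < η < 2/H. Then along the gradient-descent sequence w_{t+1} = w_t - η·∇f(w_t) from any initial point w_0, the series ∑_{t=0}^{∞} ‖∇f(w_t)‖² converges; in particular ‖∇f(w_t)‖ tends to 0 as t → ∞. -/

import Mathlib

/-- The descent lemma: a differentiable function with `H`-Lipschitz gradient lies below its
quadratic upper model at every point. -/
theorem descent_lemma {E : Type*} [NormedAddCommGroup E] [InnerProductSpace ℝ E]
    [CompleteSpace E] {f : E → ℝ} (hdiff : Differentiable ℝ f) {H : ℝ}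
    (hlip : ∀ x y, ‖gradient f x - gradient f y‖ ≤ H * ‖x - y‖) (x v : E) :
    f (x + v) ≤ f x + inner ℝ (gradient f x) v + H / 2 * ‖v‖ ^ 2 := by
  have hf : ∀ s : ℝ, HasDerivAt (fun s : ℝ => f (x + s • v))
      (inner ℝ (gradient f (x + s • v)) v) s := by
    intro s
    have hline : HasDerivAt (fun s : ℝ => x + s • v) v s := by
      simpa using ((hasDerivAt_id s).smul_const v).const_add x
    simpa [Function.comp_def] using
      (hdiff (x + s • v)).hasGradientAt.hasFDerivAt.comp_hasDerivAt s hline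
  have hB : ∀ s : ℝ, HasDerivAt
      (fun s : ℝ => f x + s * inner ℝ (gradient f x) v + H / 2 * ‖v‖ ^ 2 * s ^ 2)
      (inner ℝ (gradient f x) v + H * s * ‖v‖ ^ 2) s := by
    intro s
    refine ((((hasDerivAt_id s).mul_const (inner ℝ (gradient f x) v)).const_add (f x)).add
      ((hasDerivAt_pow 2 s).const_mul (H / 2 * ‖v‖ ^ 2))).congr_deriv ?_
    norm_num
    ring
  have key := image_le_of_deriv_right_le_deriv_boundary (a := 0) (b := 1)
    (fun s _ => (hf s).continuousAt.continuousWithinAt)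
    (fun s _ => (hf s).hasDerivWithinAt) (by simp)
    (fun s _ => (hB s).continuousAt.continuousWithinAt)
    (fun s _ => (hB s).hasDerivWithinAt)
    (fun s hs => by
      have hgrad : ‖gradient f (x + s • v) - gradient f x‖ ≤ H * (s * ‖v‖) := by
        simpa [norm_smul, abs_of_nonneg hs.1] using hlip (x + s • v) x
      have hinner := real_inner_le_norm (gradient f (x + s • v) - gradient f x) v
      rw [inner_sub_left] at hinner
      nlinarith [mul_le_mul_of_nonneg_right hgrad (norm_nonneg v)])
    (Set.right_mem_Icc.2 zero_le_one)
  simpa using key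

/-- One gradient step of size `η` decreases the function by at least
`η * (1 - H * η / 2) * ‖∇f x‖ ^ 2`. -/
theorem gradient_step_decrease {E : Type*} [NormedAddCommGroup E] [InnerProductSpace ℝ E]
    [CompleteSpace E] {f : E → ℝ} (hdiff : Differentiable ℝ f) {H : ℝ}
    (hlip : ∀ x y, ‖gradient f x - gradient f y‖ ≤ H * ‖x - y‖) (η : ℝ) (x : E) :
    η * (1 - H * η / 2) * ‖gradient f x‖ ^ 2 ≤ f x - f (x - η • gradient f x) := by
  have h := descent_lemma hdiff hlip x (-(η • gradient f x))
  rw [← sub_eq_add_neg, inner_neg_right, real_inner_smul_right, real_inner_self_eq_norm_sq,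
    norm_neg, norm_smul, mul_pow, Real.norm_eq_abs, sq_abs] at h
  linarith

/-- Gradient vanishing: for a differentiable function with `H`-Lipschitz
gradient which is bounded below, along gradient descent with step
`0 < η < 2/H`, the series `∑ ‖∇f(w_t)‖²` converges; in particular
`‖∇f(w_t)‖ → 0` as `t → ∞`. -/
theorem gradient_descent_gradient_vanishing
    (n : ℕ) (f : EuclideanSpace ℝ (Fin n) → ℝ)
    (hdiff : Differentiable ℝ f)
    (H : ℝ) (hH : 0 < H)
    (hlip : ∀ x y, ‖gradient f x - gradient f y‖ ≤ H * ‖x - y‖)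
    (hbdd : BddBelow (Set.range f))
    (η : ℝ) (hη₀ : 0 < η) (hη₁ : η < 2 / H)
    (w : ℕ → EuclideanSpace ℝ (Fin n))
    (hw : ∀ t, w (t + 1) = w t - η • gradient f (w t)) :
    Summable (fun t => ‖gradient f (w t)‖ ^ 2) ∧
      Filter.Tendsto (fun t => ‖gradient f (w t)‖) Filter.atTop (nhds 0) := by
  have hc : 0 < η * (1 - H * η / 2) := by
    rw [lt_div_iff₀ hH] at hη₁
    exact mul_pos hη₀ (by linarith)
  obtain ⟨m, hm⟩ := hbdd
  have hsum : Summable (fun t => ‖gradient f (w t)‖ ^ 2) := by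
    refine summable_of_sum_range_le (c := (f (w 0) - m) / (η * (1 - H * η / 2)))
      (fun t => sq_nonneg _) fun N => ?_
    rw [le_div_iff₀' hc, Finset.mul_sum]
    calc ∑ t ∈ Finset.range N, η * (1 - H * η / 2) * ‖gradient f (w t)‖ ^ 2
        ≤ ∑ t ∈ Finset.range N, (f (w t) - f (w (t + 1))) := by
          refine Finset.sum_le_sum fun t _ => ?_
          rw [hw t]
          exact gradient_step_decrease hdiff hlip η (w t)
      _ = f (w 0) - f (w N) := Finset.sum_range_sub' (fun t => f (w t)) N
      _ ≤ f (w 0) - m := sub_le_sub_left (hm (Set.mem_range_self _)) _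
  refine ⟨hsum, ?_⟩
  simpa [Real.sqrt_sq] using hsum.tendsto_atTop_zero.sqrt
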